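/- Let u be a future lightlike vector, let R₀ ≥ 0, and let Ω ⊆ ℝ³ be a set such that: (i) ⟨x,u⟩ ≤ -R₀ for all x ∈ Ω, and (ii) every future lightlike vector x with ⟨x,u⟩ = -(R₀+1) belongs to Ω. Let φ ∈ Isom(E^{1,2}) with φ(Ω) = Ω, and suppose the linear part φ_L has a future lightlike eigenvector v with eigenvalue α ∈ (0,1] such that v is not a scalar multiple of u. Let λ > 1, R = R₀ + 1, and 𝒰 = I⁺(λ·u) ∩ {x ∈ ℝ³ : ⟨x,u⟩ > -R}. If φ(𝒰) ∩ 𝒰 ≠ ∅, then 0 ≥ ⟨φ_L(u), u⟩ ≥ -(R₀+2)/λ. -/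

import Mathlib

noncomputable section

/-- Points/vectors of Minkowski space `E^{1,2}`. -/
abbrev V3 : Type := Fin 3 → ℝ

/-- The Minkowski bilinear form `⟨·,·⟩` of signature `(1,2)`. -/
def mb (v w : V3) : ℝ := -(v 0 * w 0) + v 1 * w 1 + v 2 * w 2

/-- The Minkowski quadratic form. -/
def mq (v : V3) : ℝ := mb v v

def futureTimelike (v : V3) : Prop := mq v < 0 ∧ 0 < v 0
def futureLightlike (v : V3) : Prop := mq v = 0 ∧ 0 < v 0
def futureCausal (v : V3) : Prop := mq v ≤ 0 ∧ 0 < v 0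

/-- `SO₀(1,2)`: linear maps preserving the form, of determinant one,
preserving the future causal cone. -/
def SO12 : Set (Matrix (Fin 3) (Fin 3) ℝ) :=
  {A | (∀ v w, mb (A.mulVec v) (A.mulVec w) = mb v w) ∧ A.det = 1 ∧
       ∀ v, futureCausal v → futureCausal (A.mulVec v)}

/-- A parabolic element of `SO₀(1,2)`. -/
def IsParabolic (A : Matrix (Fin 3) (Fin 3) ℝ) : Prop := A ≠ 1 ∧ (A - 1) ^ 3 = 0

/-- An (affine) isometry of `E^{1,2}` given by its linear part and translation part. -/
abbrev IsomE : Type := Matrix (Fin 3) (Fin 3) ℝ × V3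

/-- The action of an isometry on `ℝ³`: `φ(x) = φ_L x + τ_φ`. -/
def isomApp (g : IsomE) (x : V3) : V3 := g.1.mulVec x + g.2

/-- Composition of isometries. -/
def isomMul (g h : IsomE) : IsomE := (g.1 * h.1, g.1.mulVec h.2 + g.2)

/-- Iterated composition. -/
def isomPow (g : IsomE) : ℕ → IsomE
  | 0 => (1, 0)
  | n + 1 => isomMul g (isomPow g n)

/-- `G` is a subgroup of `Isom(E^{1,2})`. -/
def IsIsomSubgroup (G : Set IsomE) : Prop :=
  (∀ g ∈ G, g.1 ∈ SO12) ∧ ((1 : Matrix (Fin 3) (Fin 3) ℝ), (0 : V3)) ∈ G ∧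
  (∀ g ∈ G, ∀ h ∈ G, isomMul g h ∈ G) ∧
  (∀ g ∈ G, ∃ h ∈ G, isomMul g h = (1, 0) ∧ isomMul h g = (1, 0))

/-- `G` is torsionfree: its only element of finite order is the identity. -/
def IsomTorsionfree (G : Set IsomE) : Prop :=
  ∀ g ∈ G, ∀ n : ℕ, 0 < n → isomPow g n = (1, 0) → g = (1, 0)

/-- The chronological future of the lightlike plane `{x | ⟨x,u⟩ = c}`. -/
def futurePlane (u : V3) (c : ℝ) : Set V3 := {x | mb x u < c}

/-- A regular domain: a nonempty intersection of futures of lightlike planes. -/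
def IsRegularDomain (Ω : Set V3) : Prop :=
  Ω.Nonempty ∧ ∃ Λ : Set (V3 × ℝ), Λ.Nonempty ∧ (∀ p ∈ Λ, futureLightlike p.1) ∧
    Ω = ⋂ p ∈ Λ, futurePlane p.1 p.2

/-- The lightlike line `a + ℝ u`. -/
def linePts (a u : V3) : Set V3 := {x | ∃ s : ℝ, x = a + s • u}

/-- Fixed-point set of an isometry. -/
def FixSet (g : IsomE) : Set V3 := {x | isomApp g x = x}


/-- The chronological future of a point. -/
def Iplus (p : V3) : Set V3 := {y | futureTimelike (y - p)}

lemma mb_nonpos_of_futureCausal {v w : V3} (hv : futureCausal v) (hw : futureCausal w) :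
    mb v w ≤ 0 := by
  obtain ⟨hv, hv0⟩ := hv
  obtain ⟨hw, hw0⟩ := hw
  simp only [mq, mb] at *
  have h : (v 1 * w 1 + v 2 * w 2) ^ 2 ≤ (v 0 * w 0) ^ 2 := calc
    (v 1 * w 1 + v 2 * w 2) ^ 2 ≤ (v 1 ^ 2 + v 2 ^ 2) * (w 1 ^ 2 + w 2 ^ 2) := by
      nlinarith [sq_nonneg (v 1 * w 2 - v 2 * w 1)]
    _ ≤ v 0 ^ 2 * w 0 ^ 2 :=
      mul_le_mul (by linarith) (by linarith) (by positivity) (by positivity)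
    _ = (v 0 * w 0) ^ 2 := by ring
  linarith [abs_le_of_sq_le_sq' h (by positivity)]

lemma eq_smul_of_mb_eq_zero {u v : V3} (hu : futureLightlike u) (hv : futureLightlike v)
    (h : mb v u = 0) : v = (v 0 / u 0) • u := by
  obtain ⟨hu, hu0⟩ := hu
  obtain ⟨hv, -⟩ := hv
  simp only [mq, mb] at *
  have hs : (u 0 * v 1 - v 0 * u 1) ^ 2 + (u 0 * v 2 - v 0 * u 2) ^ 2 = 0 := by
    linear_combination u 0 ^ 2 * hv + v 0 ^ 2 * hu - 2 * u 0 * v 0 * h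
  have e1 : u 0 * v 1 - v 0 * u 1 = 0 := by
    nlinarith [sq_nonneg (u 0 * v 1 - v 0 * u 1), sq_nonneg (u 0 * v 2 - v 0 * u 2)]
  have e2 : u 0 * v 2 - v 0 * u 2 = 0 := by
    nlinarith [sq_nonneg (u 0 * v 1 - v 0 * u 1), sq_nonneg (u 0 * v 2 - v 0 * u 2)]
  ext i
  fin_cases i <;> simp <;> field_simp <;> linarith

lemma mb_neg_of_not_smul {u v : V3} (hu : futureLightlike u) (hv : futureLightlike v)
    (h : ∀ μ : ℝ, v ≠ μ • u) : mb v u < 0 :=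
  lt_of_le_of_ne (mb_nonpos_of_futureCausal ⟨hv.1.le, hv.2⟩ ⟨hu.1.le, hu.2⟩)
    fun h0 => h _ (eq_smul_of_mb_eq_zero hu hv h0)

lemma mb_add_left (v w u : V3) : mb (v + w) u = mb v u + mb w u := by
  simp only [mb, Pi.add_apply]; ring

lemma mb_smul_left (a : ℝ) (v u : V3) : mb (a • v) u = a * mb v u := by
  simp only [mb, Pi.smul_apply, smul_eq_mul]; ring

lemma futureLightlike.smul {v : V3} (hv : futureLightlike v) {a : ℝ} (ha : 0 < a) :
    futureLightlike (a • v) := by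
  refine ⟨?_, mul_pos ha hv.2⟩
  have h := hv.1
  simp only [mq, mb, Pi.smul_apply, smul_eq_mul] at *
  linear_combination a ^ 2 * h

/-- An isometry preserving `Ω` whose linear part contracts a lightlike vector transverse to `u`
cannot translate far to the past of the planes `⟨·,u⟩ = c`. -/
lemma mb_translation_le_one {u : V3} (hu : futureLightlike u) {R₀ : ℝ} (hR₀ : 0 ≤ R₀)
    {Ω : Set V3} (h1 : ∀ x ∈ Ω, mb x u ≤ -R₀)
    (h2 : ∀ x : V3, futureLightlike x → mb x u = -(R₀ + 1) → x ∈ Ω)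
    {φ : IsomE} (hinv : isomApp φ '' Ω = Ω) {v : V3} (hv : futureLightlike v)
    {α : ℝ} (hα1 : α ≤ 1) (heig : φ.1.mulVec v = α • v) (hnp : ∀ μ : ℝ, v ≠ μ • u) :
    mb φ.2 u ≤ 1 := by
  have hvu := mb_neg_of_not_smul hu hv hnp
  set k := (R₀ + 1) / -mb v u with hk
  have hkpos : 0 < k := div_pos (by linarith) (by linarith)
  have hkv : k * mb v u = -(R₀ + 1) := by
    rw [hk, div_neg, neg_mul, div_mul_cancel₀ _ hvu.ne]
  have hmem : k • v ∈ Ω := h2 _ (hv.smul hkpos) (by rw [mb_smul_left, hkv])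
  have himg : isomApp φ (k • v) ∈ Ω := hinv ▸ Set.mem_image_of_mem _ hmem
  have hle := h1 _ himg
  rw [isomApp, Matrix.mulVec_smul, heig, mb_add_left, smul_comm, mb_smul_left, mb_smul_left,
    hkv] at hle
  nlinarith

/-- Quantitative estimate: if `φ(𝒰) ∩ 𝒰 ≠ ∅` for the wedge neighborhood
`𝒰 = I⁺(λu) ∩ {⟨x,u⟩ > -R}`, then `0 ≥ ⟨φ_L u, u⟩ ≥ -(R₀+2)/λ`. -/
theorem stmt9 (u : V3) (hu : futureLightlike u) (R₀ : ℝ) (hR₀ : 0 ≤ R₀)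
    (Ω : Set V3)
    (h1 : ∀ x ∈ Ω, mb x u ≤ -R₀)
    (h2 : ∀ x : V3, futureLightlike x → mb x u = -(R₀ + 1) → x ∈ Ω)
    (φ : IsomE) (hφ : φ.1 ∈ SO12) (hinv : isomApp φ '' Ω = Ω)
    (v : V3) (hv : futureLightlike v) (α : ℝ) (hα0 : 0 < α) (hα1 : α ≤ 1)
    (heig : φ.1.mulVec v = α • v) (hnp : ∀ μ : ℝ, v ≠ μ • u)
    (lam : ℝ) (hlam : 1 < lam) (U : Set V3)
    (hU : U = Iplus (lam • u) ∩ {x | -(R₀ + 1) < mb x u})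
    (hmeet : (isomApp φ '' U ∩ U).Nonempty) :
    mb (φ.1.mulVec u) u ≤ 0 ∧ -(R₀ + 2) / lam ≤ mb (φ.1.mulVec u) u := by
  have hu' : futureCausal u := ⟨hu.1.le, hu.2⟩
  refine ⟨mb_nonpos_of_futureCausal (hφ.2.2 u hu') hu', ?_⟩
  have hτ := mb_translation_le_one hu hR₀ h1 h2 hinv hv hα1 heig hnp
  subst hU
  obtain ⟨_, ⟨x, hx, rfl⟩, hy⟩ := hmeet
  have hp : futureCausal (x - lam • u) := ⟨hx.1.1.le, hx.1.2⟩
  have hAp := mb_nonpos_of_futureCausal (hφ.2.2 _ hp) hu'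
  have hyR : -(R₀ + 1) < mb (isomApp φ x) u := hy.2
  have hsplit : mb (isomApp φ x) u =
      lam * mb (φ.1.mulVec u) u + mb (φ.1.mulVec (x - lam • u)) u + mb φ.2 u := by
    rw [← mb_smul_left, ← mb_add_left, ← mb_add_left, ← Matrix.mulVec_smul,
      ← Matrix.mulVec_add, add_sub_cancel, isomApp]
  rw [div_le_iff₀ (by linarith)]
  linarith
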